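/- arXiv:0803.2441 — 2 statements merged into one kernel-verified Lean document; each statement's English description precedes it below -/
import Mathlib

section
/- Let d ≥ 1 and n ≥ 2 be integers. For T > 0 define the multivariate Fejér kernel on (ℝ^d)^{n−1} by Φ*_T(u₁,…,u_{n−1}) = (2π)^{−(n−1)d} T^{−d} Δ_T(−(u₁+⋯+u_{n−1})) ∏_{e=1}^{n−1} Δ_T(u_e). Then Φ*_T is Lebesgue-integrable on (ℝ^d)^{n−1}, and for every bounded continuous function C : (ℝ^d)^{n−1} → ℂ one has lim_{T→∞} ∫_{(ℝ^d)^{n−1}} C(u₁,…,u_{n−1}) Φ*_T(u₁,…,u_{n−1}) du₁⋯du_{n−1} = C(0,…,0). -/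
open MeasureTheory Filter

/-- The continuous Dirichlet kernel `Δ_T(λ) = ∫_{[-T/2,T/2]^d} e^{i⟨t,λ⟩} dt` on `ℝ^d`. -/
noncomputable def dirichletKernel (d : ℕ) (T : ℝ) (lam : Fin d → ℝ) : ℂ :=
  ∫ t in Set.univ.pi fun _ : Fin d => Set.Icc (-(T / 2)) (T / 2),
    Complex.exp (Complex.I * ((∑ j, t j * lam j : ℝ) : ℂ))

/-- The multivariate Fejér kernel on `(ℝ^d)^m` (here `m = n - 1`):
`Φ*_T(u) = (2π)^{-m d} T^{-d} Δ_T(-(u₁+⋯+u_m)) ∏_{e=1}^m Δ_T(u_e)`. -/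
noncomputable def fejerKernel (d m : ℕ) (T : ℝ) (u : Fin m → Fin d → ℝ) : ℂ :=
  (((2 * Real.pi) ^ (m * d) * T ^ d : ℝ) : ℂ)⁻¹ *
    (dirichletKernel d T (-(∑ e, u e)) * ∏ e, dirichletKernel d T (u e))

/-- The Dirichlet kernel on the line, `∫_{-T/2}^{T/2} e^{itx} dt`. -/
noncomputable def lineKernel (T x : ℝ) : ℂ :=
  ∫ t in Set.Icc (-(T / 2)) (T / 2), Complex.exp (Complex.I * ((t * x : ℝ) : ℂ))

theorem dirichletKernel_eq_prod (d : ℕ) (T : ℝ) (lam : Fin d → ℝ) :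
    dirichletKernel d T lam = ∏ j, lineKernel T (lam j) := by
  unfold dirichletKernel lineKernel
  rw [volume_pi, Measure.restrict_pi_pi, ← integral_fintype_prod_eq_prod]
  congr 1
  ext t
  rw [← Complex.exp_sum, Complex.ofReal_sum, Finset.mul_sum]

theorem lineKernel_eq_intervalIntegral {T : ℝ} (hT : 0 ≤ T) (x : ℝ) :
    lineKernel T x =
      ∫ t in (-(T / 2))..(T / 2), Complex.exp (Complex.I * ((t * x : ℝ) : ℂ)) := by
  rw [lineKernel, integral_Icc_eq_integral_Ioc, intervalIntegral.integral_of_le (by linarith)]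

theorem lineKernel_scale {T : ℝ} (hT : 0 < T) (x : ℝ) :
    lineKernel T x = T * lineKernel 1 (T * x) := by
  rw [lineKernel_eq_intervalIntegral hT.le, lineKernel_eq_intervalIntegral zero_le_one]
  have h := intervalIntegral.smul_integral_comp_mul_left (a := -(1 / 2)) (b := 1 / 2)
    (fun t : ℝ => Complex.exp (Complex.I * ((t * x : ℝ) : ℂ))) T
  rw [show T * -(1 / 2) = -(T / 2) by ring, show T * (1 / 2) = T / 2 by ring] at h
  rw [← h, Complex.real_smul]
  congr 2
  ext t
  congr 3
  ring

theorem lineKernel_neg (T x : ℝ) : lineKernel T (-x) = lineKernel T x := by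
  unfold lineKernel
  rw [← integral_indicator measurableSet_Icc, ← integral_indicator measurableSet_Icc,
    ← integral_neg_eq_self]
  congr 1
  ext t
  simp only [Set.indicator_apply, Set.mem_Icc, neg_mul_neg]
  congr 1
  exact propext ⟨fun h => ⟨by linarith [h.2], by linarith [h.1]⟩,
    fun h => ⟨by linarith [h.2], by linarith [h.1]⟩⟩

theorem continuous_lineKernel (T : ℝ) : Continuous (lineKernel T) :=
  continuous_parametric_integral_of_continuous (by fun_prop) isCompact_Icc

theorem norm_lineKernel_one_le (x : ℝ) : ‖lineKernel 1 x‖ ≤ 1 := by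
  rw [lineKernel_eq_intervalIntegral zero_le_one]
  refine (intervalIntegral.norm_integral_le_of_norm_le_const (C := 1) fun t _ => ?_).trans ?_
  · rw [mul_comm, Complex.norm_exp_ofReal_mul_I]
  · norm_num

theorem abs_mul_norm_lineKernel_le {T : ℝ} (hT : 0 ≤ T) (x : ℝ) : |x| * ‖lineKernel T x‖ ≤ 2 := by
  rcases eq_or_ne x 0 with rfl | hx
  · simp
  have hc : Complex.I * (x : ℂ) ≠ 0 := mul_ne_zero Complex.I_ne_zero (by exact_mod_cast hx)
  have h : lineKernel T x = (Complex.exp (((T / 2 * x : ℝ) : ℂ) * Complex.I) -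
      Complex.exp (((-(T / 2) * x : ℝ) : ℂ) * Complex.I)) / (Complex.I * x) := by
    rw [lineKernel_eq_intervalIntegral hT]
    convert integral_exp_mul_complex (a := -(T / 2)) (b := T / 2) hc using 4
    all_goals push_cast; ring
  rw [h, norm_div, norm_mul, Complex.norm_I, one_mul, Complex.norm_real, Real.norm_eq_abs,
    mul_div_cancel₀ _ (abs_ne_zero.mpr hx)]
  refine (norm_sub_le _ _).trans ?_
  rw [Complex.norm_exp_ofReal_mul_I, Complex.norm_exp_ofReal_mul_I]
  norm_num

theorem integrable_norm_lineKernel_rpow {p : ℝ} (hp : 1 < p) :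
    Integrable fun x => ‖lineKernel 1 x‖ ^ p := by
  have hbound : Integrable fun x : ℝ => 3 ^ p * (1 + ‖x‖) ^ (-p) :=
    (integrable_one_add_norm (by simpa using hp)).const_mul _
  refine hbound.mono' ((continuous_lineKernel 1).norm.rpow_const
    fun _ => Or.inr (by linarith)).aestronglyMeasurable (.of_forall fun x => ?_)
  have hx : 0 < 1 + ‖x‖ := by positivity
  rw [Real.norm_of_nonneg (by positivity), Real.rpow_neg hx.le, ← div_eq_mul_inv,
    ← Real.div_rpow (by norm_num) hx.le]
  refine Real.rpow_le_rpow (norm_nonneg _) ?_ (by linarith)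
  rw [le_div_iff₀ hx]
  have h₁ := norm_lineKernel_one_le x
  have h₂ := abs_mul_norm_lineKernel_le zero_le_one x
  rw [Real.norm_eq_abs]
  linarith

theorem memLp_two_lineKernel : MemLp (lineKernel 1) 2 := by
  rw [memLp_two_iff_integrable_sq_norm (continuous_lineKernel 1).aestronglyMeasurable]
  simpa using integrable_norm_lineKernel_rpow one_lt_two

theorem integrable_lineKernel_sub_mul (y : ℝ) :
    Integrable fun v => lineKernel 1 (y - v) * lineKernel 1 v :=
  (memLp_two_lineKernel.comp_measurePreserving
    (Measure.measurePreserving_sub_left volume y)).integrable_mul memLp_two_lineKernel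

/-- The character `t ↦ e^{iyt}` cut off to the interval `[-1/2, 1/2]`. -/
noncomputable def cutoffCharacter (y : ℝ) : ℝ → ℂ :=
  (Set.Icc (-(1 / 2)) (1 / 2)).indicator fun t => Complex.exp (Complex.I * ((t * y : ℝ) : ℂ))

theorem integrable_cutoffCharacter (y : ℝ) : Integrable (cutoffCharacter y) :=
  (ContinuousOn.integrableOn_compact isCompact_Icc (by fun_prop)).integrable_indicator
    measurableSet_Icc

open FourierTransform Convolution

theorem fourier_cutoffCharacter (y w : ℝ) :
    𝓕 (cutoffCharacter y) w = lineKernel 1 (y - 2 * Real.pi * w) := by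
  rw [Real.fourier_eq', lineKernel, ← integral_indicator measurableSet_Icc]
  congr 1
  ext t
  by_cases ht : t ∈ Set.Icc (-(1 / 2) : ℝ) (1 / 2)
  · rw [cutoffCharacter, Set.indicator_of_mem ht, Set.indicator_of_mem ht, smul_eq_mul,
      ← Complex.exp_add]
    congr 1
    simp
    ring
  · rw [cutoffCharacter, Set.indicator_of_notMem ht, Set.indicator_of_notMem ht, smul_zero]

theorem convolution_cutoffCharacter (y x : ℝ) :
    (cutoffCharacter y ⋆[ContinuousLinearMap.mul ℂ ℂ] cutoffCharacter 0) x =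
      ∫ t in (x - 1 / 2)..(x + 1 / 2), cutoffCharacter y t := by
  rw [convolution, intervalIntegral.integral_of_le (by linarith), ← integral_Icc_eq_integral_Ioc,
    ← integral_indicator measurableSet_Icc]
  congr 1
  ext t
  have h : x - t ∈ Set.Icc (-(1 / 2) : ℝ) (1 / 2) ↔ t ∈ Set.Icc (x - 1 / 2) (x + 1 / 2) := by
    simp only [Set.mem_Icc]
    constructor <;> rintro ⟨h₁, h₂⟩ <;> constructor <;> linarith
  by_cases ht : t ∈ Set.Icc (x - 1 / 2) (x + 1 / 2)
  · rw [Set.indicator_of_mem ht, ContinuousLinearMap.mul_apply', cutoffCharacter.eq_1 0,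
      Set.indicator_of_mem (h.mpr ht)]
    simp
  · rw [Set.indicator_of_notMem ht, ContinuousLinearMap.mul_apply', cutoffCharacter.eq_1 0,
      Set.indicator_of_notMem (mt h.mp ht), mul_zero]

/-- Convolving the kernel on the line with itself reproduces it up to the factor `2π`. -/
theorem integral_lineKernel_sub_mul (y : ℝ) :
    ∫ v, lineKernel 1 (y - v) * lineKernel 1 v = 2 * Real.pi * lineKernel 1 y := by
  set g := cutoffCharacter y ⋆[ContinuousLinearMap.mul ℂ ℂ] cutoffCharacter 0 with hg
  have hF (w : ℝ) : 𝓕 g w =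
      lineKernel 1 (y - 2 * Real.pi * w) * lineKernel 1 (2 * Real.pi * w) := by
    rw [hg, Real.fourier_mul_convolution_eq (integrable_cutoffCharacter y)
      (integrable_cutoffCharacter 0), fourier_cutoffCharacter, fourier_cutoffCharacter, zero_sub,
      lineKernel_neg]
  have hgi : Integrable g :=
    (integrable_cutoffCharacter y).integrable_convolution _ (integrable_cutoffCharacter 0)
  have hFi : Integrable (𝓕 g) := by
    rw [funext hF]
    exact (integrable_lineKernel_sub_mul y).comp_mul_left' Real.two_pi_pos.ne'
  have hgc : Continuous g := by
    have hintegrable (a b : ℝ) : IntervalIntegrable (cutoffCharacter y) volume a b :=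
      (integrable_cutoffCharacter y).intervalIntegrable
    have hprim := intervalIntegral.continuous_primitive hintegrable 0
    have hdiff : g = fun x => (∫ t in (0 : ℝ)..(x + 1 / 2), cutoffCharacter y t) -
        ∫ t in (0 : ℝ)..(x - 1 / 2), cutoffCharacter y t := by
      ext x
      rw [hg, convolution_cutoffCharacter,
        intervalIntegral.integral_interval_sub_left (hintegrable _ _) (hintegrable _ _)]
    rw [hdiff]
    exact (hprim.comp (by fun_prop)).sub (hprim.comp (by fun_prop))
  have hg0 : g 0 = lineKernel 1 y := by
    rw [hg, convolution_cutoffCharacter, intervalIntegral.integral_of_le (by norm_num),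
      ← integral_Icc_eq_integral_Ioc, zero_sub, zero_add, cutoffCharacter,
      setIntegral_indicator measurableSet_Icc, Set.inter_self, lineKernel]
  have hinv := congrFun (hgc.fourierInv_fourier_eq hgi hFi) 0
  rw [Real.fourierInv_eq', hg0] at hinv
  simp only [inner_zero_right, mul_zero, Complex.ofReal_zero, zero_mul, Complex.exp_zero, one_smul,
    hF] at hinv
  rw [Measure.integral_comp_mul_left (fun v => lineKernel 1 (y - v) * lineKernel 1 v),
    abs_of_pos (inv_pos.mpr Real.two_pi_pos), Complex.real_smul] at hinv
  rw [← hinv]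
  push_cast
  field_simp

theorem dirichletKernel_scale (d : ℕ) {T : ℝ} (hT : 0 < T) (lam : Fin d → ℝ) :
    dirichletKernel d T lam = T ^ d * dirichletKernel d 1 (T • lam) := by
  simp only [dirichletKernel_eq_prod, lineKernel_scale hT, Finset.prod_mul_distrib,
    Finset.prod_const, Finset.card_univ, Fintype.card_fin, Pi.smul_apply, smul_eq_mul]

theorem continuous_dirichletKernel (d : ℕ) (T : ℝ) : Continuous (dirichletKernel d T) := by
  simp only [funext (dirichletKernel_eq_prod d T)]
  exact continuous_finsetProd _ fun j _ => (continuous_lineKernel T).comp (continuous_apply j)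

theorem dirichletKernel_one_zero (d : ℕ) : dirichletKernel d 1 0 = 1 := by
  simp [dirichletKernel_eq_prod, lineKernel, ← two_mul]

theorem integrable_norm_dirichletKernel_rpow (d : ℕ) {p : ℝ} (hp : 1 < p) :
    Integrable fun v => ‖dirichletKernel d 1 v‖ ^ p := by
  simp only [dirichletKernel_eq_prod, norm_prod,
    ← Real.finsetProd_rpow _ _ fun _ _ => norm_nonneg _]
  exact Integrable.fintype_prod fun _ => integrable_norm_lineKernel_rpow hp

/-- Convolving the Dirichlet kernel with itself reproduces it up to the factor `(2π)^d`. -/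
theorem integral_dirichletKernel_sub_mul (d : ℕ) (y : Fin d → ℝ) :
    ∫ v, dirichletKernel d 1 (y - v) * dirichletKernel d 1 v =
      (2 * Real.pi) ^ d * dirichletKernel d 1 y := by
  simp only [dirichletKernel_eq_prod, ← Finset.prod_mul_distrib, Pi.sub_apply]
  rw [integral_fintype_prod_volume_eq_prod fun j v => lineKernel 1 (y j - v) * lineKernel 1 v]
  simp only [integral_lineKernel_sub_mul]
  rw [Finset.prod_mul_distrib, Finset.prod_const, Finset.card_univ, Fintype.card_fin]

theorem mul_prod_le_prod_rpow {ι : Type*} [Fintype ι] [Nonempty ι] {a : ℝ} {b : ι → ℝ}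
    (ha : 0 ≤ a) (hab : ∀ i, a ≤ b i) :
    a * ∏ i, b i ≤ ∏ i, b i ^ (1 + (Fintype.card ι : ℝ)⁻¹) := by
  have hcard : (Fintype.card ι : ℝ) ≠ 0 := by exact_mod_cast Fintype.card_ne_zero
  have hb (i : ι) : 0 ≤ b i := ha.trans (hab i)
  have hsplit (i : ι) : b i ^ (1 + (Fintype.card ι : ℝ)⁻¹) =
      b i ^ (Fintype.card ι : ℝ)⁻¹ * b i := by
    rw [add_comm, Real.rpow_add_one' (hb i) (by positivity)]
  simp only [hsplit, Finset.prod_mul_distrib]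
  refine mul_le_mul_of_nonneg_right ?_ (Finset.prod_nonneg fun i _ => hb i)
  calc a = ∏ _i : ι, a ^ (Fintype.card ι : ℝ)⁻¹ := by
        rw [Finset.prod_const, Finset.card_univ, ← Real.rpow_natCast, ← Real.rpow_mul ha,
          inv_mul_cancel₀ hcard, Real.rpow_one]
    _ ≤ _ := Finset.prod_le_prod (fun i _ => Real.rpow_nonneg ha _)
        fun i _ => Real.rpow_le_rpow ha (hab i) (by positivity)

theorem measurePreserving_of_involutive {E : Type*} [NormedAddCommGroup E] [NormedSpace ℝ E]
    [MeasurableSpace E] [BorelSpace E] [FiniteDimensional ℝ E] (μ : Measure E)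
    [μ.IsAddHaarMeasure] (L : E →ₗ[ℝ] E) (hL : L ∘ₗ L = LinearMap.id) :
    MeasurePreserving L μ μ := by
  have hdet : LinearMap.det L * LinearMap.det L = 1 := by
    rw [← LinearMap.det_comp, hL, LinearMap.det_id]
  have habs : |LinearMap.det L| = 1 := by
    rcases mul_self_eq_one_iff.mp hdet with h | h <;> simp [h]
  refine ⟨L.continuous_of_finiteDimensional.measurable, ?_⟩
  rw [Measure.map_linearMap_addHaar_eq_smul_addHaar _ (left_ne_zero_of_mul_eq_one hdet), abs_inv,
    habs, inv_one, ENNReal.ofReal_one, one_smul]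

/-- Replacing one of the vectors `u j` by minus their sum is a linear map. -/
def replaceByNegSum {ι V : Type*} [Fintype ι] [DecidableEq ι] [AddCommGroup V] [Module ℝ V]
    (e : ι) : (ι → V) →ₗ[ℝ] (ι → V) where
  toFun u := Function.update u e (-∑ j, u j)
  map_add' u w := by
    rw [← Function.update_add]
    simp [Finset.sum_add_distrib, add_comm]
  map_smul' c u := by
    rw [RingHom.id_apply, ← Function.update_smul]
    simp [Finset.smul_sum]

theorem replaceByNegSum_apply {ι V : Type*} [Fintype ι] [DecidableEq ι] [AddCommGroup V]
    [Module ℝ V] (e : ι) (u : ι → V) :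
    replaceByNegSum e u = Function.update u e (-∑ j, u j) := rfl

theorem replaceByNegSum_comp_self {ι V : Type*} [Fintype ι] [DecidableEq ι] [AddCommGroup V]
    [Module ℝ V] (e : ι) :
    replaceByNegSum e ∘ₗ replaceByNegSum e = (LinearMap.id : (ι → V) →ₗ[ℝ] (ι → V)) := by
  refine LinearMap.ext fun u => ?_
  rw [LinearMap.comp_apply, LinearMap.id_apply, replaceByNegSum_apply, replaceByNegSum_apply,
    Function.update_idem, Finset.sum_update_of_mem (Finset.mem_univ e),
    Function.update_eq_self_iff, Finset.sdiff_singleton_eq_erase,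
    ← Finset.add_sum_erase _ u (Finset.mem_univ e)]
  abel

/-- The integrand of the Fejér kernel, built from a kernel `D`, is integrable as soon as `D` is
in `L^p` for every `p > 1`. -/
theorem integrable_mul_prod_of_integrable_rpow {ι V : Type*} [Fintype ι] [Nonempty ι]
    [NormedAddCommGroup V] [NormedSpace ℝ V] [FiniteDimensional ℝ V] [MeasureSpace V]
    [BorelSpace V] [(volume : Measure V).IsAddHaarMeasure] {D : V → ℂ} (hD : Continuous D)
    (hintegrable : ∀ p : ℝ, 1 < p → Integrable fun v => ‖D v‖ ^ p) :
    Integrable fun u : ι → V => D (-∑ e, u e) * ∏ e, D (u e) := by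
  classical
  have hcard : 0 < (Fintype.card ι : ℝ)⁻¹ := by
    have := Fintype.card_pos (α := ι)
    positivity
  set p : ℝ := 1 + (Fintype.card ι : ℝ)⁻¹ with hp
  set G : (ι → V) → ℝ := fun u => ∏ e, ‖D (u e)‖ ^ p with hG
  have hGi : Integrable G := Integrable.fintype_prod fun _ => hintegrable p (by linarith)
  have hG0 (u : ι → V) : 0 ≤ G u := Finset.prod_nonneg fun _ _ => by positivity
  have hbound : Integrable fun u => G u + ∑ e, G (replaceByNegSum e u) :=
    hGi.add (integrable_finsetSum _ fun e _ =>
      (measurePreserving_of_involutive volume _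
        (replaceByNegSum_comp_self e)).integrable_comp_of_integrable hGi)
  refine hbound.mono' (by fun_prop) (.of_forall fun u => ?_)
  rw [norm_mul, norm_prod]
  obtain ⟨e, he⟩ := Finite.exists_min fun e => ‖D (u e)‖
  by_cases h : ‖D (-∑ e, u e)‖ ≤ ‖D (u e)‖
  · have h₁ := mul_prod_le_prod_rpow (norm_nonneg _) fun j => h.trans (he j)
    have h₂ := Finset.sum_nonneg fun e (_ : e ∈ Finset.univ) => hG0 (replaceByNegSum e u)
    linarith
  · have hle (j : ι) : ‖D (u e)‖ ≤ ‖D (replaceByNegSum e u j)‖ := by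
      rw [replaceByNegSum_apply]
      rcases eq_or_ne j e with rfl | hj
      · rw [Function.update_self]
        exact (not_le.mp h).le
      · rw [Function.update_of_ne hj]
        exact he j
    have hswap : ‖D (-∑ e, u e)‖ * ∏ j, ‖D (u j)‖ =
        ‖D (u e)‖ * ∏ j, ‖D (replaceByNegSum e u j)‖ := by
      rw [← Finset.mul_prod_erase _ _ (Finset.mem_univ e),
        ← Finset.mul_prod_erase _ (fun j => ‖D (replaceByNegSum e u j)‖) (Finset.mem_univ e),
        replaceByNegSum_apply, Function.update_self]
      have hrest : ∏ j ∈ Finset.univ.erase e, ‖D (Function.update u e (-∑ j, u j) j)‖ =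
          ∏ j ∈ Finset.univ.erase e, ‖D (u j)‖ := Finset.prod_congr rfl fun j hj => by
        rw [Function.update_of_ne (Finset.ne_of_mem_erase hj)]
      rw [hrest]
      ring
    rw [hswap]
    have h₁ := mul_prod_le_prod_rpow (norm_nonneg _) hle
    have h₂ := Finset.single_le_sum (fun e _ => hG0 (replaceByNegSum e u)) (Finset.mem_univ e)
    have h₃ := hG0 u
    simp only [hG] at h₁ h₂ h₃ ⊢
    linarith

theorem integrable_dirichletKernel_mul_prod (d k : ℕ) :
    Integrable fun u : Fin (k + 1) → Fin d → ℝ =>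
      dirichletKernel d 1 (-∑ e, u e) * ∏ e, dirichletKernel d 1 (u e) :=
  integrable_mul_prod_of_integrable_rpow (continuous_dirichletKernel d 1)
    fun _ => integrable_norm_dirichletKernel_rpow d

theorem integral_dirichletKernel_mul_prod (d k : ℕ) :
    ∫ u : Fin k → Fin d → ℝ, dirichletKernel d 1 (-∑ e, u e) * ∏ e, dirichletKernel d 1 (u e) =
      (2 * Real.pi) ^ (k * d) := by
  induction k with
  | zero =>
    rw [volume_pi, Measure.pi_of_empty _ 0]
    simp [dirichletKernel_one_zero]
  | succ k ih =>
    have hmp := (volume_preserving_piFinSuccAbove (fun _ : Fin (k + 1) => Fin d → ℝ) 0).symm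
    have hintegrable := (hmp.integrable_comp_emb (MeasurableEquiv.measurableEmbedding _)).mpr
      (integrable_dirichletKernel_mul_prod d k)
    rw [← hmp.integral_comp']
    rw [Measure.volume_eq_prod] at hintegrable ⊢
    refine (integral_prod_symm _ hintegrable).trans ?_
    have hinner (w : Fin k → Fin d → ℝ) (v : Fin d → ℝ) :
        dirichletKernel d 1 (-∑ e, (Fin.cons v w : Fin (k + 1) → Fin d → ℝ) e) *
          ∏ e, dirichletKernel d 1 ((Fin.cons v w : Fin (k + 1) → Fin d → ℝ) e) =
        dirichletKernel d 1 (-∑ e, w e - v) * dirichletKernel d 1 v *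
          ∏ e, dirichletKernel d 1 (w e) := by
      rw [Fin.sum_univ_succ, Fin.prod_univ_succ]
      simp only [Fin.cons_zero, Fin.cons_succ, neg_add_rev, ← sub_eq_add_neg, mul_assoc]
    simp only [Function.comp_apply, MeasurableEquiv.piFinSuccAbove_symm_apply,
      Fin.insertNthEquiv_zero, Fin.consEquiv_apply, hinner]
    simp only [integral_mul_const, integral_dirichletKernel_sub_mul]
    simp only [mul_assoc, integral_const_mul, ih]
    ring

theorem integrable_fejerKernel_one (d k : ℕ) : Integrable (fejerKernel d (k + 1) 1) :=
  (integrable_dirichletKernel_mul_prod d k).const_mul _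

theorem integral_fejerKernel_one (d k : ℕ) : ∫ u, fejerKernel d k 1 u = 1 := by
  unfold fejerKernel
  rw [integral_const_mul, integral_dirichletKernel_mul_prod]
  push_cast
  rw [one_pow, mul_one, inv_mul_cancel₀]
  exact pow_ne_zero _ (mul_ne_zero two_ne_zero (by exact_mod_cast Real.pi_ne_zero))

theorem fejerKernel_scale (d k : ℕ) {T : ℝ} (hT : 0 < T) (u : Fin k → Fin d → ℝ) :
    fejerKernel d k T u = T ^ (k * d) * fejerKernel d k 1 (T • u) := by
  have hT' : (T : ℂ) ≠ 0 := by exact_mod_cast hT.ne'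
  have hpi : (Real.pi : ℂ) ≠ 0 := by exact_mod_cast Real.pi_ne_zero
  simp only [fejerKernel, dirichletKernel_scale d hT, Finset.prod_mul_distrib, Finset.prod_const,
    Finset.card_univ, Fintype.card_fin, Pi.smul_apply, ← Finset.smul_sum, smul_neg]
  push_cast
  field_simp
  ring

/-- for `d ≥ 1` and `n = m + 2 ≥ 2`, the multivariate Fejér kernel
`Φ*_T` on `(ℝ^d)^{n-1}` is Lebesgue-integrable, and for every bounded continuous
`C : (ℝ^d)^{n-1} → ℂ` one has `∫ C · Φ*_T → C(0,…,0)` as `T → ∞`. -/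
theorem fejer_kernel_integrable_and_weak_convergence (d m : ℕ) (hd : 1 ≤ d) :
    (∀ T : ℝ, 0 < T → Integrable (fejerKernel d (m + 1) T)) ∧
    (∀ C : (Fin (m + 1) → Fin d → ℝ) → ℂ, Continuous C → (∃ M : ℝ, ∀ x, ‖C x‖ ≤ M) →
      Tendsto (fun T : ℝ => ∫ u : Fin (m + 1) → Fin d → ℝ, C u * fejerKernel d (m + 1) T u)
        atTop (nhds (C 0))) := by
  refine ⟨fun T hT => ?_, fun C hC ⟨M, hM⟩ => ?_⟩
  · rw [funext (fejerKernel_scale d (m + 1) hT)]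
    exact ((integrable_fejerKernel_one d m).comp_smul hT.ne').const_mul _
  have hlim : Tendsto (fun T : ℝ => ∫ v, C (T⁻¹ • v) * fejerKernel d (m + 1) 1 v) atTop
      (nhds (∫ v, C 0 * fejerKernel d (m + 1) 1 v)) := by
    have hΦ := integrable_fejerKernel_one d m
    refine tendsto_integral_filter_of_dominated_convergence
      (fun v => M * ‖fejerKernel d (m + 1) 1 v‖) ?_ ?_ (hΦ.norm.const_mul M) ?_
    · exact .of_forall fun T => (hC.comp (by fun_prop)).aestronglyMeasurable.mul hΦ.1
    · refine .of_forall fun T => .of_forall fun v => ?_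
      rw [norm_mul]
      exact mul_le_mul_of_nonneg_right (hM _) (norm_nonneg _)
    · refine .of_forall fun v => Tendsto.mul_const _ ((hC.tendsto 0).comp ?_)
      simpa using (tendsto_inv_atTop_zero (𝕜 := ℝ)).smul_const v
  rw [integral_const_mul, integral_fejerKernel_one, mul_one] at hlim
  refine hlim.congr' ?_
  filter_upwards [eventually_gt_atTop 0] with T hT
  have hsub := Measure.integral_comp_smul volume
    (fun v : Fin (m + 1) → Fin d → ℝ => C (T⁻¹ • v) * fejerKernel d (m + 1) 1 v) T
  have hfin : Module.finrank ℝ (Fin (m + 1) → Fin d → ℝ) = (m + 1) * d := by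
    simp [Module.finrank_pi_fintype]
  have hT' : (T : ℂ) ≠ 0 := by exact_mod_cast hT.ne'
  rw [hfin, abs_of_pos (by positivity), Complex.real_smul] at hsub
  simp only [smul_smul, inv_mul_cancel₀ hT.ne', one_smul] at hsub
  simp only [fejerKernel_scale d (m + 1) hT, mul_left_comm (C _), integral_const_mul, hsub]
  push_cast
  rw [mul_inv_cancel_left₀ (pow_ne_zero _ hT')]
end

section
/- (Graph-breaking inequality for regular graphs.) Let k ≥ 2 and m ≥ 1 be integers and let G be a connected simple graph on a vertex set of cardinality k in which every vertex has degree m. Then for every set A of edges of G, the number of connected components of the graph obtained from G by deleting all edges in A is at most |A|/m + k/2. -/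
open Finset in
/-- Twice the number of connected components is at most the number of vertices plus the number
of isolated vertices. -/
theorem SimpleGraph.two_mul_card_connectedComponent_le {V : Type*} [Fintype V]
    (H : SimpleGraph V) [DecidableRel H.Adj] :
    2 * Nat.card H.ConnectedComponent ≤ Fintype.card V + #{v : V | H.degree v = 0} := by
  classical
  rw [Nat.card_eq_fintype_card, ← Finset.card_univ, ← Finset.card_univ,
    card_eq_sum_card_fiberwise (f := H.connectedComponentMk) (t := univ)
      (fun _ _ ↦ mem_coe.2 (mem_univ _)) (s := univ),
    card_eq_sum_card_fiberwise (f := H.connectedComponentMk) (t := univ)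
      (fun _ _ ↦ mem_coe.2 (mem_univ _)) (s := {v : V | H.degree v = 0}),
    ← sum_add_distrib, mul_comm, ← smul_eq_mul]
  refine card_nsmul_le_sum _ _ _ fun c _ ↦ ?_
  induction c using SimpleGraph.ConnectedComponent.ind with | _ v => ?_
  by_cases hv : H.degree v = 0
  · rw [← one_add_one_eq_two]
    refine add_le_add (card_pos.2 ⟨v, ?_⟩) (card_pos.2 ⟨v, ?_⟩) <;> simp [hv]
  · obtain ⟨w, hw⟩ := (H.degree_pos_iff_exists_adj v).1 (Nat.pos_of_ne_zero hv)
    refine le_add_right (one_lt_card.2 ⟨v, by simp, w, ?_, hw.ne⟩)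
    simpa using hw.symm.reachable

open Finset in
/-- In a regular graph, deleting the edges in `A` isolates at most `2 * #A / m` vertices. -/
theorem SimpleGraph.IsRegularOfDegree.mul_card_isolated_deleteEdges_le {V : Type*} [Fintype V]
    {G : SimpleGraph V} [DecidableRel G.Adj] {m : ℕ} (hG : G.IsRegularOfDegree m)
    {A : Finset (Sym2 V)} (hA : ↑A ⊆ G.edgeSet) [DecidableRel (G.deleteEdges ↑A).Adj] :
    m * #{v : V | (G.deleteEdges ↑A).degree v = 0} ≤ 2 * #A := by
  classical
  have hle (v : V) : (G.deleteEdges ↑A).degree v ≤ m :=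
    hG v ▸ degree_le_of_le (G.deleteEdges_le _)
  have hcard : #(G.deleteEdges ↑A).edgeFinset + #A = #G.edgeFinset := by
    rw [G.edgeFinset_deleteEdges, card_sdiff_add_card_eq_card]
    exact fun e he ↦ mem_edgeFinset.2 (hA he)
  have hsum : ∑ v, (G.deleteEdges ↑A).degree v + m * #{v : V | (G.deleteEdges ↑A).degree v = 0}
      ≤ ∑ v, G.degree v := by
    rw [mul_comm, ← smul_eq_mul, ← sum_const, sum_filter, ← sum_add_distrib]
    refine sum_le_sum fun v _ ↦ ?_
    have := hle v
    rw [hG v]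
    split_ifs <;> omega
  rw [sum_degrees_eq_twice_card_edges, sum_degrees_eq_twice_card_edges] at hsum
  omega

/-- Graph-breaking inequality for regular graphs. Let `k ≥ 2`, `m ≥ 1`,
and let `G` be a connected simple graph on `k` vertices in which every vertex has degree
`m`. Then for every set `A` of edges of `G`, the number of connected components of
`G - A` is at most `|A|/m + k/2`. -/
theorem graph_breaking_regular (k m : ℕ) (hk : 2 ≤ k) (hm : 1 ≤ m)
    (G : SimpleGraph (Fin k)) [DecidableRel G.Adj]
    (hconn : G.Connected) (hreg : G.IsRegularOfDegree m)
    (A : Finset (Sym2 (Fin k))) (hA : ↑A ⊆ G.edgeSet) :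
    (Nat.card (G.deleteEdges ↑A).ConnectedComponent : ℝ) ≤
      (A.card : ℝ) / (m : ℝ) + (k : ℝ) / 2 := by
  classical
  have hcomp := (G.deleteEdges ↑A).two_mul_card_connectedComponent_le
  have hiso := hreg.mul_card_isolated_deleteEdges_le hA
  rw [Fintype.card_fin] at hcomp
  have hm' : (0 : ℝ) < m := by exact_mod_cast hm
  rify at hcomp hiso
  rw [mul_comm, ← le_div_iff₀ hm', mul_div_assoc] at hiso
  linarith
end
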